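/- Let N ≥ 3, a, b > 0 and g : ℝ → ℝ. A function u ∈ C²(ℝ^N) with ∫_{ℝ^N}|∇u|² < ∞ satisfies the Kirchhoff equation −(a + b∫_{ℝ^N}|∇u|²)·Δu = g(u) on ℝ^N if and only if there exist v ∈ C²(ℝ^N) with ∫_{ℝ^N}|∇v|² < ∞ satisfying −Δv = g(v) on ℝ^N and t > 0 with t²·a + t^{4−N}·b·∫_{ℝ^N}|∇v|² = 1 such that u(x) = v(t·x) for all x ∈ ℝ^N. -/

import Mathlib

open MeasureTheory

/-- The Laplacian of `u : ℝ^N → ℝ`, as the sum of second partial derivatives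
along the standard basis directions. -/
noncomputable def lap {N : ℕ} (u : EuclideanSpace ℝ (Fin N) → ℝ)
    (x : EuclideanSpace ℝ (Fin N)) : ℝ :=
  ∑ i : Fin N,
    fderiv ℝ (fun y => fderiv ℝ u y (EuclideanSpace.single i 1)) x (EuclideanSpace.single i 1)

/-- The Dirichlet energy `∫_{ℝ^N} |∇u|²`. -/
noncomputable def dirichlet {N : ℕ} (u : EuclideanSpace ℝ (Fin N) → ℝ) : ℝ :=
  ∫ x, ‖gradient u x‖ ^ 2

theorem lap_comp_smul {N : ℕ} (v : EuclideanSpace ℝ (Fin N) → ℝ) (t : ℝ)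
    (x : EuclideanSpace ℝ (Fin N)) :
    lap (fun y => v (t • y)) x = t ^ 2 * lap v (t • x) := by
  unfold lap
  rw [Finset.mul_sum]
  refine Finset.sum_congr rfl fun i _ => ?_
  have h : (fun y => fderiv ℝ (fun y => v (t • y)) y (EuclideanSpace.single i 1)) =
      t • fun y => (fun z => fderiv ℝ v z (EuclideanSpace.single i 1)) (t • y) := by
    funext y
    rw [fderiv_comp_smul]
    rfl
  rw [h, fderiv_const_smul_field, Pi.smul_apply,
    fderiv_comp_smul (f := fun z => fderiv ℝ v z (EuclideanSpace.single i 1))]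
  simp only [smul_apply, smul_eq_mul]
  ring

theorem norm_gradient_comp_smul_sq {F : Type*} [NormedAddCommGroup F] [InnerProductSpace ℝ F]
    [CompleteSpace F] (v : F → ℝ) (t : ℝ) (x : F) :
    ‖gradient (fun y => v (t • y)) x‖ ^ 2 = t ^ 2 * ‖gradient v (t • x)‖ ^ 2 := by
  simp only [gradient, LinearIsometryEquiv.norm_map]
  rw [fderiv_comp_smul, norm_smul, mul_pow, Real.norm_eq_abs, sq_abs]

theorem dirichlet_comp_smul {N : ℕ} (v : EuclideanSpace ℝ (Fin N) → ℝ) {t : ℝ} (ht : 0 < t) :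
    dirichlet (fun y => v (t • y)) = t ^ ((2 : ℝ) - N) * dirichlet v := by
  simp only [dirichlet, norm_gradient_comp_smul_sq]
  rw [integral_const_mul,
    Measure.integral_comp_smul volume (fun z => ‖gradient v z‖ ^ 2) t, finrank_euclideanSpace_fin,
    abs_of_pos (by positivity), smul_eq_mul, ← mul_assoc, Real.rpow_sub ht, Real.rpow_natCast,
    Real.rpow_two, div_eq_mul_inv]

theorem integrable_norm_gradient_comp_smul_sq {N : ℕ} {v : EuclideanSpace ℝ (Fin N) → ℝ} {t : ℝ}
    (ht : t ≠ 0) (hv : Integrable (fun x => ‖gradient v x‖ ^ 2)) :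
    Integrable (fun x => ‖gradient (fun y => v (t • y)) x‖ ^ 2) := by
  simp only [norm_gradient_comp_smul_sq]
  exact (hv.comp_smul ht).const_mul _

theorem dirichlet_nonneg {N : ℕ} (u : EuclideanSpace ℝ (Fin N) → ℝ) : 0 ≤ dirichlet u :=
  integral_nonneg fun _ => by positivity

/-- The normalisation of the scaling factor, expressed through the rescaled function. -/
theorem scaling_constraint {N : ℕ} (a b : ℝ) (v : EuclideanSpace ℝ (Fin N) → ℝ) {t : ℝ}
    (ht : 0 < t) :
    t ^ 2 * a + t ^ ((4 : ℝ) - N) * b * dirichlet v =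
      t ^ 2 * (a + b * dirichlet (fun y => v (t • y))) := by
  have h : t ^ ((4 : ℝ) - N) = t ^ 2 * t ^ ((2 : ℝ) - N) := by
    rw [← Real.rpow_two, ← Real.rpow_add ht]
    ring_nf
  rw [dirichlet_comp_smul v ht, h]
  ring

theorem stmt2 {N : ℕ} (hN : 3 ≤ N) (a b : ℝ) (ha : 0 < a) (hb : 0 < b)
    (g : ℝ → ℝ) (u : EuclideanSpace ℝ (Fin N) → ℝ)
    (hu : ContDiff ℝ 2 u)
    (huInt : Integrable (fun x => ‖gradient u x‖ ^ 2)) :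
    (∀ x, -((a + b * dirichlet u) * lap u x) = g (u x)) ↔
    ∃ (v : EuclideanSpace ℝ (Fin N) → ℝ) (t : ℝ),
      ContDiff ℝ 2 v ∧
      Integrable (fun x => ‖gradient v x‖ ^ 2) ∧
      (∀ x, -lap v x = g (v x)) ∧
      0 < t ∧
      t ^ 2 * a + t ^ ((4 : ℝ) - N) * b * dirichlet v = 1 ∧
      ∀ x, u x = v (t • x) := by
  constructor
  · intro h
    have hM : 0 < a + b * dirichlet u := by
      have := dirichlet_nonneg u
      positivity
    set M := a + b * dirichlet u with hMdef
    have ht : 0 < (√M)⁻¹ := inv_pos.2 (Real.sqrt_pos.2 hM)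
    have hs : (√M) ^ 2 = M := Real.sq_sqrt hM.le
    have huv : (fun x => u (√M • (√M)⁻¹ • x)) = u := by
      funext x
      rw [smul_inv_smul₀ (Real.sqrt_pos.2 hM).ne']
    refine ⟨fun y => u (√M • y), (√M)⁻¹, hu.comp (contDiff_id.const_smul _),
      integrable_norm_gradient_comp_smul_sq (Real.sqrt_pos.2 hM).ne' huInt, fun x => ?_, ht, ?_,
      fun x => (congrFun huv x).symm⟩
    · rw [lap_comp_smul, hs]
      exact h _
    · rw [scaling_constraint a b _ ht, huv, ← hMdef, inv_pow, hs, inv_mul_cancel₀ hM.ne']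
  · rintro ⟨v, t, -, -, hv, ht, hc, huv⟩ x
    obtain rfl : u = fun y => v (t • y) := funext huv
    rw [scaling_constraint a b v ht] at hc
    rw [lap_comp_smul, ← hv, ← mul_assoc, mul_comm _ (t ^ 2), hc, one_mul]
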